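/- The polynomial D is invariant under translations of a quadratic differential system: for every (x₀,y₀) ∈ ℝ², if p̃(x,y) = p(x+x₀, y+y₀) and q̃(x,y) = q(x+x₀, y+y₀), then D computed from the system (p̃, q̃) is equal, as a polynomial in (x,y), to D computed from the system (p, q). -/

import Mathlib

open MvPolynomial

noncomputable section

/-- The monomial exponent `x^i·y^j`. -/
def mono (i j : ℕ) : Fin 2 →₀ ℕ :=
  Finsupp.single (0 : Fin 2) i + Finsupp.single (1 : Fin 2) j

/-- `D(x,y) = 4·det(c_ij)` where `x·Q(X,Y,Z) − y·P(X,Y,Z)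
  = c11·X² + 2c12·XY + c22·Y² + 2c13·XZ + 2c23·YZ + c33·Z²`,
`P, Q` being the degree-2 homogenizations of `p, q`.  (Writing
`p = a00 + a10·x + a01·y + a20·x² + 2a11·xy + a02·y²` and similarly `q` with `b`'s,
`c11 = b20·x − a20·y`, `c12 = b11·x − a11·y`, `c22 = b02·x − a02·y`,
`c13 = (b10·x − a10·y)/2`, `c23 = (b01·x − a01·y)/2`, `c33 = b00·x − a00·y`.) -/
def Dof (p q : MvPolynomial (Fin 2) ℝ) : MvPolynomial (Fin 2) ℝ :=
  let c11 : MvPolynomial (Fin 2) ℝ :=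
    C (MvPolynomial.coeff (mono 2 0) q) * X 0 - C (MvPolynomial.coeff (mono 2 0) p) * X 1
  let c12 : MvPolynomial (Fin 2) ℝ :=
    C (MvPolynomial.coeff (mono 1 1) q / 2) * X 0
      - C (MvPolynomial.coeff (mono 1 1) p / 2) * X 1
  let c22 : MvPolynomial (Fin 2) ℝ :=
    C (MvPolynomial.coeff (mono 0 2) q) * X 0 - C (MvPolynomial.coeff (mono 0 2) p) * X 1
  let c13 : MvPolynomial (Fin 2) ℝ :=
    C (MvPolynomial.coeff (mono 1 0) q / 2) * X 0
      - C (MvPolynomial.coeff (mono 1 0) p / 2) * X 1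
  let c23 : MvPolynomial (Fin 2) ℝ :=
    C (MvPolynomial.coeff (mono 0 1) q / 2) * X 0
      - C (MvPolynomial.coeff (mono 0 1) p / 2) * X 1
  let c33 : MvPolynomial (Fin 2) ℝ :=
    C (MvPolynomial.coeff (mono 0 0) q) * X 0 - C (MvPolynomial.coeff (mono 0 0) p) * X 1
  4 * Matrix.det !![c11, c12, c13; c12, c22, c23; c13, c23, c33]

/-- The translate of a polynomial: `f(x + x₀, y + y₀)`. -/
def translatePoly (x₀ y₀ : ℝ) (f : MvPolynomial (Fin 2) ℝ) : MvPolynomial (Fin 2) ℝ :=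
  MvPolynomial.aeval ![X 0 + C x₀, X 1 + C y₀] f

theorem mono_inj (i j k l : ℕ) : mono i j = mono k l ↔ i = k ∧ j = l := by
  constructor
  · intro h
    have h0 := DFunLike.congr_fun h 0
    have h1 := DFunLike.congr_fun h 1
    simp [mono] at h0 h1
    exact ⟨h0, h1⟩
  · rintro ⟨rfl, rfl⟩; rfl

theorem eq_mono (m : Fin 2 →₀ ℕ) : m = mono (m 0) (m 1) := by
  ext i
  fin_cases i <;> simp [mono]

theorem monomial_mono (i j : ℕ) (a : ℝ) :
    monomial (mono i j) a = C a * X (0 : Fin 2) ^ i * X 1 ^ j := by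
  rw [mono, X_pow_eq_monomial, X_pow_eq_monomial, C_mul_monomial, monomial_mul]
  simp

def quadPoly (a b c d e g : ℝ) : MvPolynomial (Fin 2) ℝ :=
  monomial (mono 2 0) a + monomial (mono 1 1) b + monomial (mono 0 2) c
    + monomial (mono 1 0) d + monomial (mono 0 1) e + monomial (mono 0 0) g

theorem eq_quadPoly (f : MvPolynomial (Fin 2) ℝ) (hf : f.totalDegree ≤ 2) :
    ∃ a b c d e g, f = quadPoly a b c d e g := by
  refine ⟨coeff (mono 2 0) f, coeff (mono 1 1) f, coeff (mono 0 2) f,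
    coeff (mono 1 0) f, coeff (mono 0 1) f, coeff (mono 0 0) f, ?_⟩
  ext m
  rw [eq_mono m]
  generalize m 0 = i
  generalize m 1 = j
  by_cases h : i + j ≤ 2
  · have hi : i ≤ 2 := by omega
    have hj : j ≤ 2 := by omega
    interval_cases i <;> interval_cases j <;>
      first
      | omega
      | simp [quadPoly, coeff_monomial, mono_inj]
  · have : coeff (mono i j) f = 0 := by
      apply coeff_eq_zero_of_totalDegree_lt
      have hs : ∑ k ∈ (mono i j).support, (mono i j) k = i + j := by
        have := Finsupp.sum_fintype (mono i j) (fun _ n => n) (by simp)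
        simpa [Finsupp.sum, mono] using this
      rw [hs]; omega
    rw [this]
    simp only [quadPoly, coeff_add, coeff_monomial, mono_inj]
    repeat rw [if_neg (by omega)]
    simp

theorem translate_quadPoly (x y a b c d e g : ℝ) :
    translatePoly x y (quadPoly a b c d e g) =
      quadPoly a b c (2 * a * x + b * y + d) (b * x + 2 * c * y + e)
        (a * x ^ 2 + b * x * y + c * y ^ 2 + d * x + e * y + g) := by
  simp only [translatePoly, quadPoly, monomial_mono]
  have h2 : (C 2 : MvPolynomial (Fin 2) ℝ) = 2 := map_ofNat C 2
  simp [algebraMap_eq, h2]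
  ring

/-- The polynomial `D` is invariant under translations of a quadratic differential
system. -/
theorem D_translation_invariant
    (p q : MvPolynomial (Fin 2) ℝ)
    (hdeg : max p.totalDegree q.totalDegree = 2)
    (x₀ y₀ : ℝ) :
    Dof (translatePoly x₀ y₀ p) (translatePoly x₀ y₀ q) = Dof p q := by
  have hp : p.totalDegree ≤ 2 := (le_max_left _ _).trans hdeg.le
  have hq : q.totalDegree ≤ 2 := (le_max_right _ _).trans hdeg.le
  obtain ⟨a, b, c, d, e, g, rfl⟩ := eq_quadPoly p hp
  obtain ⟨a', b', c', d', e', g', rfl⟩ := eq_quadPoly q hq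
  have half : ∀ r : ℝ, ∃ s, r = 2 * s := fun r => ⟨r / 2, by ring⟩
  obtain ⟨b, rfl⟩ := half b
  obtain ⟨d, rfl⟩ := half d
  obtain ⟨e, rfl⟩ := half e
  obtain ⟨b', rfl⟩ := half b'
  obtain ⟨d', rfl⟩ := half d'
  obtain ⟨e', rfl⟩ := half e'
  have k1 : ∀ a b d : ℝ, (2 * a * x₀ + 2 * b * y₀ + 2 * d) / 2 = a * x₀ + b * y₀ + d := by
    intros; ring
  have k2 : ∀ b c e : ℝ, (2 * b * x₀ + 2 * c * y₀ + 2 * e) / 2 = b * x₀ + c * y₀ + e := by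
    intros; ring
  have k3 : ∀ b : ℝ, 2 * b / 2 = b := by intros; ring
  have h2 : (C 2 : MvPolynomial (Fin 2) ℝ) = 2 := map_ofNat C 2
  rw [translate_quadPoly, translate_quadPoly]
  simp [Dof, quadPoly, coeff_monomial, mono_inj, k1, k3, Matrix.det_fin_three, h2]
  ring
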